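/- Under Assumptions 1 and 2, the PIAG algorithm with step size 0 < η ≤ 1/(L(K+1)) satisfies the recursion (1 + ημ/8) F_{k+1} ≤ (1 − Σ_{i=1}^{a−1} ε_i) F_k + Σ_{i=1}^{a−1} ε_i F_{k−iK} + η²(KL/2) ε_{a−1} Σ_{j=k−aK}^{k−1} ‖d_j‖², for any integer a ≥ 2 and k ≥ aK+1, where ε_i = 2ηL(ηKL)^{i−1}. -/

import Mathlib

open Finset in
/-- Each index of the wider window lies in at most `K` of the inner windows. -/
lemma sum_window_sum_window_le {D : ℕ → ℝ} (hD : ∀ j, 0 ≤ D j) (K i k : ℕ) :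
    ∑ j ∈ Ico (k - i * K) k, ∑ l ∈ Ico (j - K) j, D l
      ≤ K * ∑ l ∈ Ico (k - (i + 1) * K) k, D l := by
  have hswap : ∑ j ∈ Ico (k - i * K) k, ∑ l ∈ Ico (j - K) j, D l
      = ∑ l ∈ Ico (k - (i + 1) * K) k,
          ∑ j ∈ Ico (k - i * K) k with l ∈ Ico (j - K) j, D l := by
    apply sum_comm'
    intro j l
    simp only [mem_Ico, mem_filter]
    constructor
    · rintro ⟨⟨h1, h2⟩, h3, h4⟩
      refine ⟨⟨⟨h1, h2⟩, h3, h4⟩, ?_, by omega⟩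
      rw [add_mul, one_mul]
      omega
    · rintro ⟨⟨h1, h2⟩, -⟩
      exact ⟨h1, h2⟩
  rw [hswap, mul_sum]
  refine sum_le_sum fun l _ => ?_
  rw [sum_const, nsmul_eq_mul]
  refine mul_le_mul_of_nonneg_right ?_ (hD l)
  have hsub : (Ico (k - i * K) k).filter (fun j => l ∈ Ico (j - K) j) ⊆ Ioc l (l + K) := by
    intro j
    simp only [mem_Ico, mem_filter, mem_Ioc]
    omega
  have hcard := card_le_card hsub
  rw [Nat.card_Ioc] at hcard
  exact_mod_cast hcard.trans (by omega)

open Finset in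
/-- Unrolling of a windowed descent inequality over `b` windows. -/
lemma window_sum_le_of_descent {D F : ℕ → ℝ} (hD : ∀ j, 0 ≤ D j) {K : ℕ} {η L : ℝ}
    (hη : 0 < η) (hL : 0 < L)
    (hdesc : ∀ j, F (j + 1) ≤ F j - η / 2 * D j + η ^ 2 * L / 2 * ∑ l ∈ Ico (j - K) j, D l)
    (k b : ℕ) :
    η ^ 2 * L * ∑ j ∈ Ico (k - K) k, D j
      ≤ ∑ i ∈ Icc 1 b, 2 * η * L * (η * K * L) ^ (i - 1) * (F (k - i * K) - F k)
        + η ^ 2 * L * (η * K * L) ^ b * ∑ j ∈ Ico (k - (b + 1) * K) k, D j := by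
  induction b with
  | zero => simp
  | succ b ih =>
    rw [sum_Icc_succ_top (by omega)]
    have htel : ∀ p, p ≤ k → ∑ j ∈ Ico p k, (F j - F (j + 1)) = F p - F k := fun p hp => by
      rw [← neg_inj, ← sum_neg_distrib]
      simp only [neg_sub]
      exact sum_Ico_sub F hp
    have hsum : η * ∑ j ∈ Ico (k - (b + 1) * K) k, D j
        ≤ 2 * (F (k - (b + 1) * K) - F k)
          + η ^ 2 * L * ∑ j ∈ Ico (k - (b + 1) * K) k, ∑ l ∈ Ico (j - K) j, D l := by
      rw [← htel _ (Nat.sub_le _ _), mul_sum, mul_sum, mul_sum, ← sum_add_distrib]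
      refine sum_le_sum fun j _ => ?_
      linarith [hdesc j]
    have hwin := mul_le_mul_of_nonneg_left (sum_window_sum_window_le hD K (b + 1) k)
      (by positivity : 0 ≤ η ^ 2 * L)
    have hstep := mul_le_mul_of_nonneg_left (hsum.trans (add_le_add_right hwin _))
      (by positivity : 0 ≤ η * L * (η * K * L) ^ b)
    simp only [Nat.add_sub_cancel]
    rw [pow_succ _ b]
    linarith

section InnerProduct

variable {E : Type*} [NormedAddCommGroup E] [InnerProductSpace ℝ E]

/-- The proximal step `p` from `w` yields the subgradient `(w - p) / η` of `r` at `p`. -/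
lemma inner_le_of_prox {r : E → ℝ} (hr : ConvexOn ℝ Set.univ r) {η : ℝ} (hη : 0 < η) {p w : E}
    (hp : ∀ z, 1 / 2 * ‖p - w‖ ^ 2 + η * r p ≤ 1 / 2 * ‖z - w‖ ^ 2 + η * r z) (z : E) :
    η * r p ≤ η * r z + inner ℝ (p - w) (z - p) := by
  have hstep : ∀ t : ℝ, t ∈ Set.Ioc 0 1 →
      η * r p ≤ η * r z + inner ℝ (p - w) (z - p) + t * (1 / 2 * ‖z - p‖ ^ 2) := by
    rintro t ⟨ht0, ht1⟩
    have hconv := hr.2 (Set.mem_univ p) (Set.mem_univ z) (sub_nonneg.2 ht1) ht0.le (by ring)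
    have hpt := hp ((1 - t) • p + t • z)
    have hsplit : (1 - t) • p + t • z - w = (p - w) + t • (z - p) := by module
    rw [hsplit, norm_add_sq_real (p - w), real_inner_smul_right, norm_smul, mul_pow,
      Real.norm_eq_abs, sq_abs] at hpt
    simp only [smul_eq_mul] at hconv
    have hconv' := mul_le_mul_of_nonneg_left hconv hη.le
    refine le_of_mul_le_mul_left ?_ ht0
    linarith
  have hlim : Filter.Tendsto
      (fun t : ℝ => η * r z + inner ℝ (p - w) (z - p) + t * (1 / 2 * ‖z - p‖ ^ 2))
      (nhdsWithin 0 (Set.Ioi 0)) (nhds (η * r z + inner ℝ (p - w) (z - p))) := by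
    have hcont : Continuous
        (fun t : ℝ => η * r z + inner ℝ (p - w) (z - p) + t * (1 / 2 * ‖z - p‖ ^ 2)) := by
      fun_prop
    simpa using (hcont.tendsto 0).mono_left nhdsWithin_le_nhds
  refine ge_of_tendsto hlim ?_
  filter_upwards [Ioc_mem_nhdsGT (zero_lt_one' ℝ)] with t ht using hstep t ht

variable [CompleteSpace E]

lemma HasGradientAt.hasDerivAt_line {f : E → ℝ} {G : E} {x v : E} {t : ℝ}
    (h : HasGradientAt f G (x + t • v)) :
    HasDerivAt (fun s : ℝ => f (x + s • v)) (inner ℝ G v) t := by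
  have hline : HasDerivAt (fun s : ℝ => x + s • v) v t := by
    simpa using ((hasDerivAt_id t).smul_const v).const_add x
  exact (h.hasFDerivAt.comp_hasDerivAt t hline).congr_deriv (by simp)

/-- Descent lemma for a function with `L`-Lipschitz gradient. -/
lemma le_add_inner_add_sq_of_lipschitz_gradient {f : E → ℝ} {G : E → E} {L : ℝ}
    (hG : ∀ z, HasGradientAt f (G z) z) (hLip : ∀ y z, ‖G y - G z‖ ≤ L * ‖y - z‖) (x v : E) :
    f (x + v) ≤ f x + inner ℝ (G x) v + L / 2 * ‖v‖ ^ 2 := by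
  let ψ : ℝ → ℝ := fun t => f (x + t • v) - t * inner ℝ (G x) v - L / 2 * ‖v‖ ^ 2 * t ^ 2
  have hψ : ∀ t, HasDerivAt ψ
      (inner ℝ (G (x + t • v)) v - inner ℝ (G x) v - L * ‖v‖ ^ 2 * t) t := fun t => by
    have h := (((hG (x + t • v)).hasDerivAt_line).sub
      ((hasDerivAt_id t).mul_const (inner ℝ (G x) v))).sub
      (((hasDerivAt_id t).pow 2).const_mul (L / 2 * ‖v‖ ^ 2))
    refine h.congr_deriv ?_
    simp only [id_eq]
    norm_num
    ring
  have hanti : AntitoneOn ψ (Set.Ici 0) := by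
    refine antitoneOn_of_hasDerivWithinAt_nonpos (convex_Ici 0)
      (fun t _ => (hψ t).continuousAt.continuousWithinAt)
      (fun t _ => (hψ t).hasDerivWithinAt) fun t ht => ?_
    rw [interior_Ici, Set.mem_Ioi] at ht
    rw [← inner_sub_left]
    have hbound := hLip (x + t • v) x
    rw [add_sub_cancel_left, norm_smul, Real.norm_of_nonneg ht.le] at hbound
    nlinarith [real_inner_le_norm (G (x + t • v) - G x) v,
      mul_le_mul_of_nonneg_right hbound (norm_nonneg v)]
  have h01 := hanti (Set.mem_Ici.2 le_rfl) (Set.mem_Ici.2 zero_le_one) zero_le_one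
  simp only [ψ, one_smul, zero_smul, add_zero] at h01
  linarith

/-- First-order characterization of strong convexity. -/
lemma add_inner_add_sq_le_of_strongly_convex {f : E → ℝ} {G : E} {μ : ℝ} {x : E}
    (hG : HasGradientAt f G x)
    (hsc : ConvexOn ℝ Set.univ (fun z => f z - μ / 2 * ‖z‖ ^ 2)) (v : E) :
    f x + inner ℝ G v + μ / 2 * ‖v‖ ^ 2 ≤ f (x + v) := by
  let φ : ℝ → ℝ := fun t => f (x + t • v) - μ / 2 * ‖x + t • v‖ ^ 2
  have hφ : ConvexOn ℝ Set.univ φ := by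
    have hline : φ = (fun z => f z - μ / 2 * ‖z‖ ^ 2) ∘ AffineMap.lineMap x (x + v) := by
      ext t
      simp [φ, AffineMap.lineMap_apply, add_comm]
    rw [hline]
    exact hsc.comp_affineMap (AffineMap.lineMap x (x + v))
  have hsq : ∀ t : ℝ, ‖x + t • v‖ ^ 2 = ‖x‖ ^ 2 + 2 * t * inner ℝ x v + t ^ 2 * ‖v‖ ^ 2 := by
    intro t
    rw [norm_add_sq_real, real_inner_smul_right, norm_smul, mul_pow, Real.norm_eq_abs, sq_abs]
    ring
  have hderiv : HasDerivAt φ (inner ℝ G v - μ * inner ℝ x v) 0 := by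
    have hf : HasDerivAt (fun s : ℝ => f (x + s • v)) (inner ℝ G v) 0 :=
      HasGradientAt.hasDerivAt_line (by simpa using hG)
    have hq := (((((hasDerivAt_id (0 : ℝ)).const_mul 2).mul_const (inner ℝ x v)).const_add
      (‖x‖ ^ 2)).add (((hasDerivAt_id (0 : ℝ)).pow 2).mul_const (‖v‖ ^ 2))).const_mul (μ / 2)
    have hφeq : φ = fun t => f (x + t • v)
        - μ / 2 * (‖x‖ ^ 2 + 2 * t * inner ℝ x v + t ^ 2 * ‖v‖ ^ 2) := by
      ext t
      simp only [φ, hsq]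
    rw [hφeq]
    refine (hf.sub hq).congr_deriv ?_
    simp
    ring
  have hslope := hφ.le_slope_of_hasDerivAt (Set.mem_univ 0) (Set.mem_univ 1) zero_lt_one hderiv
  simp only [slope_def_field, φ, hsq, one_smul, zero_smul, add_zero] at hslope
  norm_num at hslope
  linarith

end InnerProduct


/-- Theorem 1 of the paper: for `0 < η ≤ 1/(L(K+1))`, any integer `a ≥ 2` and
`k ≥ aK + 1`, with `ε_i = 2ηL(ηKL)^{i-1}`,
`(1 + ημ/8) F_{k+1} ≤ (1 - ∑ ε_i) F_k + ∑ ε_i F_{k-iK}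
  + η²(KL/2) ε_{a-1} ∑_{j=k-aK}^{k-1} ‖d_j‖²`. -/
theorem stmt12
    {n m K : ℕ} (hm : 0 < m)
    (f : Fin m → EuclideanSpace ℝ (Fin n) → ℝ) (Li : Fin m → ℝ)
    (hLi : ∀ i, 0 ≤ Li i)
    (hdiff : ∀ i, Differentiable ℝ (f i))
    (hLip : ∀ i x y, ‖gradient (f i) x - gradient (f i) y‖ ≤ Li i * ‖x - y‖)
    (fs : EuclideanSpace ℝ (Fin n) → ℝ)
    (hfs : ∀ z, fs z = (m : ℝ)⁻¹ * ∑ i, f i z)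
    (L : ℝ) (hL : L = (m : ℝ)⁻¹ * ∑ i, Li i) (hLpos : 0 < L)
    (μ : ℝ) (hμ : 0 < μ)
    (hsc : ConvexOn ℝ Set.univ (fun z => fs z - μ / 2 * ‖z‖ ^ 2))
    (r : EuclideanSpace ℝ (Fin n) → ℝ)
    (hr : ConvexOn ℝ Set.univ r) (hrlsc : LowerSemicontinuous r)
    (η : ℝ) (hη : 0 < η)
    (x : ℕ → EuclideanSpace ℝ (Fin n))
    (τ : Fin m → ℕ → ℕ) (hτ : ∀ i k, k - K ≤ τ i k ∧ τ i k ≤ k)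
    (g : ℕ → EuclideanSpace ℝ (Fin n))
    (hg : ∀ k, g k = (m : ℝ)⁻¹ • ∑ i, gradient (f i) (x (τ i k)))
    (hiter : ∀ (k : ℕ) (z : EuclideanSpace ℝ (Fin n)),
      1 / 2 * ‖x (k + 1) - (x k - η • g k)‖ ^ 2 + η * r (x (k + 1))
        ≤ 1 / 2 * ‖z - (x k - η • g k)‖ ^ 2 + η * r z)
    (d : ℕ → EuclideanSpace ℝ (Fin n)) (hd : ∀ k, d k = η⁻¹ • (x (k + 1) - x k))
    (xs : EuclideanSpace ℝ (Fin n)) (hxs : ∀ z, fs xs + r xs ≤ fs z + r z)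
    (Fk : ℕ → ℝ) (hFk : ∀ k, Fk k = fs (x k) + r (x k) - (fs xs + r xs))
    (hηle : η ≤ 1 / (L * (K + 1)))
    (a : ℕ) (ha : 2 ≤ a)
    (ε : ℕ → ℝ) (hε : ∀ i, ε i = 2 * η * L * (η * K * L) ^ (i - 1))
    (k : ℕ) (hk : a * K + 1 ≤ k) :
    (1 + η * μ / 8) * Fk (k + 1)
      ≤ (1 - ∑ i ∈ Finset.Icc 1 (a - 1), ε i) * Fk k
        + ∑ i ∈ Finset.Icc 1 (a - 1), ε i * Fk (k - i * K)
        + η ^ 2 * (K * L / 2) * ε (a - 1) * ∑ j ∈ Finset.Ico (k - a * K) k, ‖d j‖ ^ 2 := by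
  have hm0 : (0 : ℝ) < (m : ℝ)⁻¹ := by positivity
  set G : EuclideanSpace ℝ (Fin n) → EuclideanSpace ℝ (Fin n) :=
    fun z => (m : ℝ)⁻¹ • ∑ i, gradient (f i) z with hGdef
  have hG : ∀ z, HasGradientAt fs (G z) z := fun z => by
    have hsum : HasFDerivAt (fun y => (m : ℝ)⁻¹ * ∑ i, f i y)
        ((m : ℝ)⁻¹ • ∑ i, InnerProductSpace.toDual ℝ _ (gradient (f i) z)) z :=
      (HasFDerivAt.fun_sum fun i _ => (hdiff i z).hasGradientAt.hasFDerivAt).const_mul _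
    rw [funext hfs, hasGradientAt_iff_hasFDerivAt]
    simpa [hGdef] using hsum
  have hagg : ∀ (y : Fin m → EuclideanSpace ℝ (Fin n)) (z : EuclideanSpace ℝ (Fin n)) (B : ℝ),
      (∀ i, ‖y i - z‖ ≤ B) →
      ‖(m : ℝ)⁻¹ • ∑ i, gradient (f i) (y i) - G z‖ ≤ L * B := fun y z B hB => by
    rw [hGdef, ← smul_sub, ← Finset.sum_sub_distrib, norm_smul, Real.norm_of_nonneg hm0.le, hL,
      mul_assoc, Finset.sum_mul]
    refine mul_le_mul_of_nonneg_left ((norm_sum_le _ _).trans (Finset.sum_le_sum fun i _ => ?_))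
      hm0.le
    exact (hLip i _ _).trans (mul_le_mul_of_nonneg_left (hB i) (hLi i))
  have hGLip : ∀ y z, ‖G y - G z‖ ≤ L * ‖y - z‖ := fun y z =>
    hagg (fun _ => y) z _ fun _ => le_rfl
  have hx : ∀ j, x (j + 1) = x j + η • d j := fun j => by
    rw [hd, smul_inv_smul₀ hη.ne', add_sub_cancel]
  have hstep : ∀ j, ‖x j - x (j + 1)‖ = η * ‖d j‖ := fun j => by
    rw [hx, sub_add_cancel_left, norm_neg, norm_smul, Real.norm_of_nonneg hη.le]
  have hdelay : ∀ i j, ‖x (τ i j) - x j‖ ≤ η * ∑ l ∈ Finset.Ico (j - K) j, ‖d l‖ := fun i j => by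
    rw [← dist_eq_norm, Finset.mul_sum]
    refine (dist_le_Ico_sum_dist x (hτ i j).2).trans ?_
    simp only [dist_eq_norm, hstep]
    exact Finset.sum_le_sum_of_subset_of_nonneg (Finset.Ico_subset_Ico_left (hτ i j).1)
      fun l _ _ => by positivity
  have hsqsum : ∀ j, (∑ l ∈ Finset.Ico (j - K) j, ‖d l‖) ^ 2
      ≤ K * ∑ l ∈ Finset.Ico (j - K) j, ‖d l‖ ^ 2 := fun j => by
    refine sq_sum_le_card_mul_sum_sq.trans (mul_le_mul_of_nonneg_right ?_ (by positivity))
    rw [Nat.card_Ico]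
    exact_mod_cast (by omega : j - (j - K) ≤ K)
  have hsub : ∀ j z, r (x (j + 1)) ≤ r z + inner ℝ (d j + g j) (z - x (j + 1)) := fun j z => by
    have h := inner_le_of_prox hr hη (hiter j) z
    have hdir : x (j + 1) - (x j - η • g j) = η • (d j + g j) := by
      rw [hx]; module
    rw [hdir, real_inner_smul_left] at h
    refine le_of_mul_le_mul_left ?_ hη
    linarith
  have hηL : η * L * (K + 1) ≤ 1 := by
    rw [le_div_iff₀ (by positivity)] at hηle
    linarith
  have hdesc : ∀ j, Fk (j + 1) ≤ Fk j - η / 2 * ‖d j‖ ^ 2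
      + η ^ 2 * L / 2 * ∑ l ∈ Finset.Ico (j - K) j, ‖d l‖ ^ 2 := fun j => by
    have hf := le_add_inner_add_sq_of_lipschitz_gradient hG hGLip (x j) (η • d j)
    rw [← hx, real_inner_smul_right, norm_smul, mul_pow, Real.norm_of_nonneg hη.le] at hf
    have hrj := hsub j (x j)
    have hback : x j - x (j + 1) = -(η • d j) := by rw [hx]; abel
    rw [hback, inner_neg_right, real_inner_smul_right, inner_add_left,
      real_inner_self_eq_norm_sq] at hrj
    have herr : ‖g j - G (x j)‖ ≤ L * (η * ∑ l ∈ Finset.Ico (j - K) j, ‖d l‖) := by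
      rw [hg]
      exact hagg (fun i => x (τ i j)) (x j) _ fun i => hdelay i j
    have hcs : -inner ℝ (g j - G (x j)) (d j)
        ≤ L * (η * ∑ l ∈ Finset.Ico (j - K) j, ‖d l‖) * ‖d j‖ :=
      (neg_le_abs _).trans ((abs_real_inner_le_norm _ _).trans
        (mul_le_mul_of_nonneg_right herr (norm_nonneg _)))
    rw [inner_sub_left] at hcs
    have hyoung : (∑ l ∈ Finset.Ico (j - K) j, ‖d l‖) * ‖d j‖
        ≤ 1 / 2 * ∑ l ∈ Finset.Ico (j - K) j, ‖d l‖ ^ 2 + K / 2 * ‖d j‖ ^ 2 := by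
      have hcard : ((Finset.Ico (j - K) j).card : ℝ) ≤ K := by
        rw [Nat.card_Ico]
        exact_mod_cast (by omega : j - (j - K) ≤ K)
      have hpt : (∑ l ∈ Finset.Ico (j - K) j, ‖d l‖) * ‖d j‖
          ≤ ∑ l ∈ Finset.Ico (j - K) j, (1 / 2 * ‖d l‖ ^ 2 + 1 / 2 * ‖d j‖ ^ 2) := by
        rw [Finset.sum_mul]
        exact Finset.sum_le_sum fun l _ => by linarith [two_mul_le_add_sq ‖d l‖ ‖d j‖]
      rw [Finset.sum_add_distrib, ← Finset.mul_sum, Finset.sum_const, nsmul_eq_mul] at hpt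
      linarith [mul_le_mul_of_nonneg_right hcard (sq_nonneg ‖d j‖)]
    have hcs' := mul_le_mul_of_nonneg_left hcs hη.le
    have hyoung' := mul_le_mul_of_nonneg_left hyoung (by positivity : 0 ≤ η ^ 2 * L)
    have hgap := mul_le_mul_of_nonneg_right hηL (by positivity : 0 ≤ η / 2 * ‖d j‖ ^ 2)
    rw [hFk, hFk]
    linarith
  have hgrad : μ / 4 * Fk (k + 1) ≤ ‖d k‖ ^ 2
      + η * L * ∑ l ∈ Finset.Ico (k - K) k, ‖d l‖ ^ 2 := by
    have hf := add_inner_add_sq_le_of_strongly_convex (hG (x (k + 1))) hsc (xs - x (k + 1))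
    rw [add_sub_cancel] at hf
    have hrk := hsub k xs
    set S := ∑ l ∈ Finset.Ico (k - K) k, ‖d l‖
    set v := xs - x (k + 1)
    set u := d k + (g k - G (x (k + 1))) with hu
    have hu_inner : inner ℝ (d k + g k) v - inner ℝ (G (x (k + 1))) v = inner ℝ u v := by
      rw [← inner_sub_left, hu, add_sub_assoc]
    have hFu : μ / 4 * Fk (k + 1) ≤ 1 / 8 * ‖u‖ ^ 2 := by
      have hsq : 2 * μ * inner ℝ u v ≤ ‖u‖ ^ 2 + μ ^ 2 * ‖v‖ ^ 2 := by
        nlinarith [real_inner_le_norm u v, sq_nonneg (‖u‖ - μ * ‖v‖)]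
      have hle : Fk (k + 1) ≤ inner ℝ u v - μ / 2 * ‖v‖ ^ 2 := by
        rw [hFk]
        linarith
      linarith [mul_le_mul_of_nonneg_left hle hμ.le]
    have herr : ‖g k - G (x (k + 1))‖ ≤ L * (η * S + η * ‖d k‖) := by
      rw [hg]
      refine hagg (fun i => x (τ i k)) (x (k + 1)) _ fun i => ?_
      have htri := norm_sub_le_norm_sub_add_norm_sub (x (τ i k)) (x k) (x (k + 1))
      rw [hstep] at htri
      linarith [hdelay i k]
    have hSnn : 0 ≤ S := by positivity
    have hLη : 0 < η * L := by positivity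
    have hK0 : (0 : ℝ) ≤ K := by positivity
    have hLη1 : η * L ≤ 1 := by nlinarith
    have hLηK : η * L * K ≤ 1 := by nlinarith
    have hunorm : ‖u‖ ≤ 2 * ‖d k‖ + η * L * S := by
      have htri := norm_add_le (d k) (g k - G (x (k + 1)))
      linarith [mul_le_mul_of_nonneg_right hLη1 (norm_nonneg (d k))]
    have husq : ‖u‖ ^ 2 ≤ 8 * ‖d k‖ ^ 2 + 2 * (η * L) ^ 2 * S ^ 2 := by
      nlinarith [pow_le_pow_left₀ (norm_nonneg u) hunorm 2,
        sq_nonneg (2 * ‖d k‖ - η * L * S)]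
    have hSS := mul_le_mul_of_nonneg_left (hsqsum k) (by positivity : 0 ≤ (η * L) ^ 2)
    have hKT := mul_le_mul_of_nonneg_right hLηK
      (by positivity : 0 ≤ η * L * ∑ l ∈ Finset.Ico (k - K) k, ‖d l‖ ^ 2)
    have hT' : 0 ≤ η * L * ∑ l ∈ Finset.Ico (k - K) k, ‖d l‖ ^ 2 := by positivity
    linarith
  obtain ⟨b, rfl⟩ : ∃ b, a = b + 1 + 1 := ⟨a - 2, by omega⟩
  have hunroll := window_sum_le_of_descent (fun j => sq_nonneg ‖d j‖) hη hLpos hdesc k (b + 1)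
  have hgrad' := mul_le_mul_of_nonneg_left hgrad (by positivity : 0 ≤ η / 2)
  simp only [hε, Nat.add_sub_cancel] at hunroll ⊢
  simp only [mul_sub, Finset.sum_sub_distrib, ← Finset.sum_mul] at hunroll
  rw [pow_succ _ b] at hunroll
  linarith [hdesc k]
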